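/- The subspace C is 4-dimensional and equals the space of all polynomials p ∈ H₃ vanishing at each of the 12 icosahedron vertices (0, ±τ, ±1), (±1, 0, ±τ), (±τ, ±1, 0) in ℝ³; moreover H₃ = A_Ico ⊕ C, and both A_Ico and C are invariant under the substitution action of every element of Ico. -/

import Mathlib

noncomputable section

open MvPolynomial Matrix

/-- The polynomial ring `ℝ[x,y,z]`. -/
abbrev P3 := MvPolynomial (Fin 3) ℝ

/-- `SO(3)`, realised as a set of real 3×3 matrices. -/
def SO3 : Set (Matrix (Fin 3) (Fin 3) ℝ) := {A | A * Aᵀ = 1 ∧ A.det = 1}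

/-- The substitution action of a matrix `A` on polynomials: `(A · p)(w) = p (A⁻¹ w)`,
i.e. the variable `Xᵢ` is replaced by `∑ⱼ (A⁻¹)ᵢⱼ Xⱼ`. -/
def sAct (A : Matrix (Fin 3) (Fin 3) ℝ) (p : P3) : P3 :=
  aeval (fun i => ∑ j, A⁻¹ i j • (X j : P3)) p

/-- The Laplace operator on polynomials in three variables. -/
def lap : P3 →ₗ[ℝ] P3 :=
  ∑ i : Fin 3, ((pderiv i).toLinearMap ∘ₗ (pderiv i).toLinearMap)

/-- `H₃`: the space of harmonic homogeneous cubic polynomials in `x, y, z`. -/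
def H3 : Submodule ℝ P3 :=
  homogeneousSubmodule (Fin 3) ℝ 3 ⊓ LinearMap.ker lap

/-- The orthonormal basis `e₁, …, e₇` of `H₃` (with `x = X 0`, `y = X 1`, `z = X 2`). -/
def eH : Fin 7 → P3 :=
  ![(1 / 5 : ℝ) • (X 0 * (2 * X 0 ^ 2 - 3 * X 1 ^ 2 - 3 * X 2 ^ 2)),
    (Real.sqrt 6 / 10) • (X 2 * (4 * X 0 ^ 2 - X 1 ^ 2 - X 2 ^ 2)),
    (Real.sqrt 6 / 10) • (X 1 * (4 * X 0 ^ 2 - X 1 ^ 2 - X 2 ^ 2)),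
    (2 * Real.sqrt 15 / 5) • (X 0 * X 1 * X 2),
    (Real.sqrt 15 / 5) • (X 0 * (X 1 ^ 2 - X 2 ^ 2)),
    (Real.sqrt 10 / 10) • (X 2 * (3 * X 1 ^ 2 - X 2 ^ 2)),
    (Real.sqrt 10 / 10) • (X 1 * (X 1 ^ 2 - 3 * X 2 ^ 2))]

/-- The identification of `ℝ⁷` (coordinates) with `H₃`, via the basis `e₁, …, e₇`. -/
def iotaH (v : Fin 7 → ℝ) : P3 := ∑ i, v i • eH i

/-- The subset of `H₃` corresponding to a coordinate subspace `E ⊆ ℝ⁷`. -/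
def polySet (E : Submodule ℝ (Fin 7 → ℝ)) : Set P3 := iotaH '' (E : Set (Fin 7 → ℝ))

/-- The inner product of `H₃` making `e₁, …, e₇` orthonormal, in coordinates. -/
def dot7 (u v : Fin 7 → ℝ) : ℝ := ∑ i, u i * v i

/-- The 3×3 minor determinant `(eⁱ ∧ eʲ ∧ eᵏ) (u, v, w)`. -/
def triD (u v w : Fin 7 → ℝ) (i j k : Fin 7) : ℝ :=
  Matrix.det !![u i, u j, u k; v i, v j, v k; w i, w j, w k]

/-- The 3-form `φ₀ = e¹²³ + e¹⁴⁵ − e¹⁶⁷ + e²⁴⁶ + e²⁵⁷ + e³⁴⁷ − e³⁵⁶`, in coordinates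
(indices shifted by one: `eᵢ = e (i-1)`). -/
def phi0 (u v w : Fin 7 → ℝ) : ℝ :=
  triD u v w 0 1 2 + triD u v w 0 3 4 - triD u v w 0 5 6 + triD u v w 1 3 5 +
    triD u v w 1 4 6 + triD u v w 2 3 6 - triD u v w 2 4 5

/-- A 3-dimensional subspace `E` of `H₃` (in coordinates) is associative if it has an
orthonormal basis `(u, v, w)` with `φ₀ (u, v, w) = ±1`. -/
def IsAssocSubspace (E : Submodule ℝ (Fin 7 → ℝ)) : Prop :=
  ∃ u v w : Fin 7 → ℝ, u ∈ E ∧ v ∈ E ∧ w ∈ E ∧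
    dot7 u u = 1 ∧ dot7 v v = 1 ∧ dot7 w w = 1 ∧
    dot7 u v = 0 ∧ dot7 u w = 0 ∧ dot7 v w = 0 ∧
    Submodule.span ℝ {u, v, w} = E ∧ (phi0 u v w = 1 ∨ phi0 u v w = -1)

/-- The subspace `E ⊆ H₃` is invariant under the substitution action of `A`: `A · E = E`. -/
def InvUnder (A : Matrix (Fin 3) (Fin 3) ℝ) (E : Submodule ℝ (Fin 7 → ℝ)) : Prop :=
  sAct A '' polySet E = polySet E

/-- The `SO(3)`-stabiliser of a subspace `E ⊆ H₃`: `{A ∈ SO(3) | A · E = E}`. -/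
def stabSO3 (E : Submodule ℝ (Fin 7 → ℝ)) : Set (Matrix (Fin 3) (Fin 3) ℝ) :=
  {A | A ∈ SO3 ∧ InvUnder A E}

/-- The subset `S` of a monoid is a subgroup isomorphic to the group `G`. -/
def SetIsoGroup {M : Type*} [Monoid M] (S : Set M) (G : Type*) [Group G] : Prop :=
  ∃ f : G → M, Function.Injective f ∧ (∀ a b, f (a * b) = f a * f b) ∧ Set.range f = S

/-- The rotation `R_α` about the x-axis through the angle `α`. -/
def Rmat (α : ℝ) : Matrix (Fin 3) (Fin 3) ℝ :=
  !![1, 0, 0; 0, Real.cos α, -Real.sin α; 0, Real.sin α, Real.cos α]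

/-- `A₁₂₃ = span (e₁, e₂, e₃)`, in coordinates. -/
def A123 : Submodule ℝ (Fin 7 → ℝ) :=
  Submodule.span ℝ {![1, 0, 0, 0, 0, 0, 0], ![0, 1, 0, 0, 0, 0, 0], ![0, 0, 1, 0, 0, 0, 0]}

/-- `A₁₄₅ = span (e₁, e₄, e₅)`, in coordinates. -/
def A145 : Submodule ℝ (Fin 7 → ℝ) :=
  Submodule.span ℝ {![1, 0, 0, 0, 0, 0, 0], ![0, 0, 0, 1, 0, 0, 0], ![0, 0, 0, 0, 1, 0, 0]}

/-- `A₁₆₇ = span (e₁, e₆, e₇)`, in coordinates. -/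
def A167 : Submodule ℝ (Fin 7 → ℝ) :=
  Submodule.span ℝ {![1, 0, 0, 0, 0, 0, 0], ![0, 0, 0, 0, 0, 1, 0], ![0, 0, 0, 0, 0, 0, 1]}

/-- The golden ratio `τ = (1+√5)/2`. -/
def gtau : ℝ := (1 + Real.sqrt 5) / 2

/-- The icosahedral group `Ico ≅ A₅ ⊂ SO(3)`: the group (= multiplicative closure, as all
generators have finite order) generated by the three listed rotations. -/
def IcoSet : Set (Matrix (Fin 3) (Fin 3) ℝ) :=
  (Submonoid.closure {!![-1, 0, 0; 0, -1, 0; 0, 0, 1], !![0, 0, 1; 1, 0, 0; 0, 1, 0],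
      (1 / 2 : ℝ) • !![1, -gtau, 1 / gtau; gtau, 1 / gtau, -1; 1 / gtau, 1, gtau]} :
    Submonoid (Matrix (Fin 3) (Fin 3) ℝ))

/-- `A_Ico`, in coordinates with respect to the basis `e₁, …, e₇`. -/
def AIco : Submodule ℝ (Fin 7 → ℝ) :=
  Submodule.span ℝ
    {![1, 0, 0, 0, Real.sqrt 3, 0, 0],
      ![0, Real.sqrt 3 * (Real.sqrt 5 - 1), 0, 0, 0, -(3 + Real.sqrt 5), 0],
      ![0, 0, Real.sqrt 3 * (1 + Real.sqrt 5), 0, 0, 0, 3 - Real.sqrt 5]}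

/-- `C = span (e₄, √3e₁−e₅, (3+√5)e₂+√3(√5−1)e₆, (√5−3)e₃+√3(1+√5)e₇)`, in coordinates. -/
def Cico : Submodule ℝ (Fin 7 → ℝ) :=
  Submodule.span ℝ
    {![0, 0, 0, 1, 0, 0, 0],
      ![Real.sqrt 3, 0, 0, 0, -1, 0, 0],
      ![0, 3 + Real.sqrt 5, 0, 0, 0, Real.sqrt 3 * (Real.sqrt 5 - 1), 0],
      ![0, 0, Real.sqrt 5 - 3, 0, 0, 0, Real.sqrt 3 * (1 + Real.sqrt 5)]}

/-- The 12 vertices `(0, ±τ, ±1), (±1, 0, ±τ), (±τ, ±1, 0)` of the icosahedron. -/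
def IcoVerts : Set (Fin 3 → ℝ) :=
  {u | ∃ s t : ℝ, (s = 1 ∨ s = -1) ∧ (t = 1 ∨ t = -1) ∧
    (u = ![0, s * gtau, t] ∨ u = ![s, 0, t * gtau] ∨ u = ![s * gtau, t, 0])}

/-- `iotaH` as a linear map. -/
def iotaL : (Fin 7 → ℝ) →ₗ[ℝ] P3 := Fintype.linearCombination ℝ eH

/-- `sAct A` as an algebra homomorphism. -/
def sActHom (A : Matrix (Fin 3) (Fin 3) ℝ) : P3 →ₐ[ℝ] P3 :=
  aeval (fun i => ∑ j, A⁻¹ i j • (X j : P3))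

theorem polySet_eq_map (E : Submodule ℝ (Fin 7 → ℝ)) : polySet E = (E.map iotaL : Set P3) := by
  rw [polySet, Submodule.map_coe]
  rfl

theorem sActHom_mul (A B : Matrix (Fin 3) (Fin 3) ℝ) (p : P3) :
    sActHom (A * B) p = sActHom A (sActHom B p) := by
  have : sActHom (A * B) = (sActHom A).comp (sActHom B) := by
    apply MvPolynomial.algHom_ext
    intro i
    simp only [sActHom, AlgHom.comp_apply, aeval_X, Matrix.mul_inv_rev, map_sum, map_smul,
      Matrix.mul_apply, Finset.sum_smul, Finset.smul_sum, smul_smul]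
    exact Finset.sum_comm
  rw [this]; rfl

theorem sActHom_one (p : P3) : sActHom 1 p = p := by
  have : sActHom 1 = AlgHom.id ℝ P3 := by
    apply MvPolynomial.algHom_ext
    intro i
    simp [sActHom, Matrix.one_apply]
  rw [this]; rfl

theorem InvUnder.one (E : Submodule ℝ (Fin 7 → ℝ)) : InvUnder 1 E := by
  have : sAct 1 = id := funext sActHom_one
  rw [InvUnder, this, Set.image_id]

theorem InvUnder.mul {A B : Matrix (Fin 3) (Fin 3) ℝ} {E : Submodule ℝ (Fin 7 → ℝ)}
    (hA : InvUnder A E) (hB : InvUnder B E) : InvUnder (A * B) E := by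
  have : sAct (A * B) = sAct A ∘ sAct B := funext (sActHom_mul A B)
  rw [InvUnder, this, Set.image_comp, hB, hA]

/-- For invertible `A`, stability of a finite-dimensional space implies invariance. -/
theorem invUnder_of_mapsTo {A B : Matrix (Fin 3) (Fin 3) ℝ} (hBA : B * A = 1)
    {E : Submodule ℝ (Fin 7 → ℝ)} (h : ∀ p ∈ polySet E, sActHom A p ∈ polySet E) :
    InvUnder A E := by
  have hinj : Function.Injective (sActHom A).toLinearMap := by
    refine Function.LeftInverse.injective (g := sActHom B) fun p => ?_
    change sActHom B (sActHom A p) = p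
    rw [← sActHom_mul, hBA, sActHom_one]
  rw [polySet_eq_map] at h
  have hle : (E.map iotaL).map (sActHom A).toLinearMap ≤ E.map iotaL := by
    rintro _ ⟨p, hp, rfl⟩
    exact h p hp
  have heq := Submodule.eq_of_le_of_finrank_eq hle
    (LinearEquiv.finrank_eq (Submodule.equivMapOfInjective _ hinj _)).symm
  rw [InvUnder, polySet_eq_map]
  exact congrArg (fun W : Submodule ℝ P3 => (W : Set P3)) heq

theorem gtau_sq : gtau ^ 2 = gtau + 1 := by
  have h : Real.sqrt 5 ^ 2 = 5 := Real.sq_sqrt (by norm_num)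
  rw [gtau]
  linear_combination h / 4

theorem one_div_gtau : 1 / gtau = gtau - 1 := by
  have h : gtau ≠ 0 := by rw [gtau]; positivity
  field_simp
  linear_combination -gtau_sq

theorem sqrt_five_eq : Real.sqrt 5 = 2 * gtau - 1 := by rw [gtau]; ring

/-- The cubic `x (x² + 3 τ⁻¹ y² - 3 τ z²)`; its cyclic shifts span `A_Ico`. -/
def cubicA {R : Type*} [CommRing R] (t x y z : R) : R :=
  x * (x ^ 2 + 3 * (t - 1) * y ^ 2 - 3 * t * z ^ 2)

/-- The cubic `x (x² - τ² y² - τ⁻² z²)`; together with `xyz` its cyclic shifts span `C`. -/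
def cubicC {R : Type*} [CommRing R] (t x y z : R) : R :=
  x * (x ^ 2 - (t + 1) * y ^ 2 - (2 - t) * z ^ 2)

theorem mem_AIco {v : Fin 7 → ℝ} : v ∈ AIco ↔ ∃ a b c : ℝ,
    v = ![a, b * (Real.sqrt 3 * (Real.sqrt 5 - 1)), c * (Real.sqrt 3 * (1 + Real.sqrt 5)), 0,
      a * Real.sqrt 3, -(b * (3 + Real.sqrt 5)), c * (3 - Real.sqrt 5)] := by
  simp only [AIco, Submodule.mem_span_insert, Submodule.mem_span_singleton]
  constructor
  · rintro ⟨a, _, ⟨b, _, ⟨c, rfl⟩, rfl⟩, rfl⟩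
    refine ⟨a, b, c, ?_⟩
    ext i; fin_cases i <;> simp [-neg_add_rev]
  · rintro ⟨a, b, c, rfl⟩
    refine ⟨a, _, ⟨b, _, ⟨c, rfl⟩, rfl⟩, ?_⟩
    ext i; fin_cases i <;> simp [-neg_add_rev]

theorem mem_Cico {v : Fin 7 → ℝ} : v ∈ Cico ↔ ∃ d a b c : ℝ,
    v = ![a * Real.sqrt 3, b * (3 + Real.sqrt 5), c * (Real.sqrt 5 - 3), d, -a,
      b * (Real.sqrt 3 * (Real.sqrt 5 - 1)), c * (Real.sqrt 3 * (1 + Real.sqrt 5))] := by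
  simp only [Cico, Submodule.mem_span_insert, Submodule.mem_span_singleton]
  constructor
  · rintro ⟨d, _, ⟨a, _, ⟨b, _, ⟨c, rfl⟩, rfl⟩, rfl⟩, rfl⟩
    refine ⟨d, a, b, c, ?_⟩
    ext i; fin_cases i <;> simp
  · rintro ⟨d, a, b, c, rfl⟩
    refine ⟨d, _, ⟨a, _, ⟨b, _, ⟨c, rfl⟩, rfl⟩, rfl⟩, ?_⟩
    ext i; fin_cases i <;> simp

theorem eval_iotaH (u : Fin 3 → ℝ) (v : Fin 7 → ℝ) : eval u (iotaH v) =
    v 0 * (1 / 5 * (u 0 * (2 * u 0 ^ 2 - 3 * u 1 ^ 2 - 3 * u 2 ^ 2))) +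
    v 1 * (√2 * √3 / 10 * (u 2 * (4 * u 0 ^ 2 - u 1 ^ 2 - u 2 ^ 2))) +
    v 2 * (√2 * √3 / 10 * (u 1 * (4 * u 0 ^ 2 - u 1 ^ 2 - u 2 ^ 2))) +
    v 3 * (2 * (√3 * √5) / 5 * (u 0 * u 1 * u 2)) +
    v 4 * (√3 * √5 / 5 * (u 0 * (u 1 ^ 2 - u 2 ^ 2))) +
    v 5 * (√2 * √5 / 10 * (u 2 * (3 * u 1 ^ 2 - u 2 ^ 2))) +
    v 6 * (√2 * √5 / 10 * (u 1 * (u 1 ^ 2 - 3 * u 2 ^ 2))) := by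
  have h6 : √6 = √2 * √3 := by rw [← Real.sqrt_mul (by norm_num)]; norm_num
  have h10 : √10 = √2 * √5 := by rw [← Real.sqrt_mul (by norm_num)]; norm_num
  have h15 : √15 = √3 * √5 := by rw [← Real.sqrt_mul (by norm_num)]; norm_num
  simp only [iotaH, Fin.sum_univ_seven, eH, ← h6, ← h10, ← h15]
  simp [smul_eval]

/-- The general element of `A_Ico` as a polynomial. -/
def polyA (a b c : ℝ) : P3 :=
  C a * cubicA (C gtau) (X 0) (X 1) (X 2) + C b * cubicA (C gtau) (X 1) (X 2) (X 0) +
    C c * cubicA (C gtau) (X 2) (X 0) (X 1)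

/-- The general element of `C` as a polynomial. -/
def polyC (d a b c : ℝ) : P3 :=
  C d * (X 0 * X 1 * X 2) + C a * cubicC (C gtau) (X 0) (X 1) (X 2) +
    C b * cubicC (C gtau) (X 1) (X 2) (X 0) + C c * cubicC (C gtau) (X 2) (X 0) (X 1)

theorem eval_polyA (a b c : ℝ) (u : Fin 3 → ℝ) : eval u (polyA a b c) =
    a * cubicA gtau (u 0) (u 1) (u 2) + b * cubicA gtau (u 1) (u 2) (u 0) +
      c * cubicA gtau (u 2) (u 0) (u 1) := by
  simp [polyA, cubicA]

theorem eval_polyC (d a b c : ℝ) (u : Fin 3 → ℝ) : eval u (polyC d a b c) =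
    d * (u 0 * u 1 * u 2) + a * cubicC gtau (u 0) (u 1) (u 2) +
      b * cubicC gtau (u 1) (u 2) (u 0) + c * cubicC gtau (u 2) (u 0) (u 1) := by
  simp [polyC, cubicC]

theorem mem_polySet_AIco {p : P3} : p ∈ polySet AIco ↔ ∃ a b c : ℝ, p = polyA a b c := by
  have h3 : √3 ^ 2 = 3 := Real.sq_sqrt (by norm_num)
  have h2 : √2 ^ 2 = 2 := Real.sq_sqrt (by norm_num)
  have key (a b c : ℝ) : iotaH ![a, b * (√3 * (√5 - 1)), c * (√3 * (1 + √5)), 0,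
      a * √3, -(b * (3 + √5)), c * (3 - √5)] =
      polyA (2 / 5 * a) (-(4 * √2 / 5) * c) (4 * √2 / 5 * b) := by
    apply MvPolynomial.funext
    intro u
    rw [eval_iotaH, eval_polyA]
    simp only [cubicA, sqrt_five_eq]
    simp
    have ht := gtau_sq
    generalize gtau = t at *
    grind
  constructor
  · rintro ⟨v, hv, rfl⟩
    obtain ⟨a, b, c, rfl⟩ := mem_AIco.1 hv
    exact ⟨_, _, _, key a b c⟩
  · rintro ⟨a, b, c, rfl⟩
    refine ⟨_, mem_AIco.2 ⟨5 / 2 * a, 5 * √2 / 8 * c, -(5 * √2 / 8 * b), rfl⟩, ?_⟩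
    rw [key]
    congr 1 <;> grind

theorem mem_polySet_Cico {p : P3} : p ∈ polySet Cico ↔ ∃ d a b c : ℝ, p = polyC d a b c := by
  have h3 : √3 ^ 2 = 3 := Real.sq_sqrt (by norm_num)
  have h2 : √2 ^ 2 = 2 := Real.sq_sqrt (by norm_num)
  have h5 : √5 ^ 2 = 5 := Real.sq_sqrt (by norm_num)
  have key (d a b c : ℝ) : iotaH ![a * √3, b * (3 + √5), c * (√5 - 3), d, -a,
      b * (√3 * (√5 - 1)), c * (√3 * (1 + √5))] =
      polyC (2 * √3 * √5 / 5 * d) (2 * √3 / 5 * a) (4 * √2 * √3 / 5 * c)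
        (-(4 * √2 * √3 / 5 * b)) := by
    apply MvPolynomial.funext
    intro u
    rw [eval_iotaH, eval_polyC]
    simp only [cubicC, sqrt_five_eq]
    simp
    have ht := gtau_sq
    generalize gtau = t at *
    grind
  constructor
  · rintro ⟨v, hv, rfl⟩
    obtain ⟨d, a, b, c, rfl⟩ := mem_Cico.1 hv
    exact ⟨_, _, _, _, key d a b c⟩
  · rintro ⟨d, a, b, c, rfl⟩
    refine ⟨_, mem_Cico.2 ⟨√3 * √5 / 6 * d, 5 * √3 / 6 * a, -(5 * √2 * √3 / 24 * c),
      5 * √2 * √3 / 24 * b, rfl⟩, ?_⟩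
    rw [key]
    congr 1 <;> grind

theorem eval_sActHom {A B : Matrix (Fin 3) (Fin 3) ℝ} (h : B * A = 1) (u : Fin 3 → ℝ) (p : P3) :
    eval u (sActHom A p) = eval (B *ᵥ u) p := by
  have hB : A⁻¹ = B := Matrix.inv_eq_left_inv h
  have : (aeval u).comp (sActHom A) = aeval (R := ℝ) (B *ᵥ u) := by
    apply MvPolynomial.algHom_ext
    intro i
    simp [sActHom, hB, Matrix.mulVec, dotProduct]
  exact DFunLike.congr_fun this p

theorem invUnder_of_eval {A B : Matrix (Fin 3) (Fin 3) ℝ} (hBA : B * A = 1)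
    (hA : ∀ a b c : ℝ, ∃ a' b' c' : ℝ, ∀ u,
      eval (B *ᵥ u) (polyA a b c) = eval u (polyA a' b' c'))
    (hC : ∀ d a b c : ℝ, ∃ d' a' b' c' : ℝ, ∀ u,
      eval (B *ᵥ u) (polyC d a b c) = eval u (polyC d' a' b' c')) :
    InvUnder A AIco ∧ InvUnder A Cico := by
  constructor
  · refine invUnder_of_mapsTo hBA fun p hp => ?_
    obtain ⟨a, b, c, rfl⟩ := mem_polySet_AIco.1 hp
    obtain ⟨a', b', c', h⟩ := hA a b c
    exact mem_polySet_AIco.2 ⟨a', b', c', MvPolynomial.funext fun u => by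
      rw [eval_sActHom hBA, h]⟩
  · refine invUnder_of_mapsTo hBA fun p hp => ?_
    obtain ⟨d, a, b, c, rfl⟩ := mem_polySet_Cico.1 hp
    obtain ⟨d', a', b', c', h⟩ := hC d a b c
    exact mem_polySet_Cico.2 ⟨d', a', b', c', MvPolynomial.funext fun u => by
      rw [eval_sActHom hBA, h]⟩

theorem invUnder_halfTurn : InvUnder !![-1, 0, 0; 0, -1, 0; 0, 0, 1] AIco ∧
    InvUnder !![-1, 0, 0; 0, -1, 0; 0, 0, 1] Cico := by
  refine invUnder_of_eval (B := !![-1, 0, 0; 0, -1, 0; 0, 0, 1])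
    (by simp [Matrix.one_fin_three])
    (fun a b c => ⟨-a, -b, c, fun u => ?_⟩) (fun d a b c => ⟨d, -a, -b, c, fun u => ?_⟩) <;>
  simp [eval_polyA, eval_polyC, cubicA, cubicC, dotProduct, Fin.sum_univ_three]

theorem invUnder_cyclic : InvUnder !![0, 0, 1; 1, 0, 0; 0, 1, 0] AIco ∧
    InvUnder !![0, 0, 1; 1, 0, 0; 0, 1, 0] Cico := by
  refine invUnder_of_eval (B := !![0, 1, 0; 0, 0, 1; 1, 0, 0])
    (by simp [Matrix.one_fin_three])
    (fun a b c => ⟨c, a, b, fun u => ?_⟩) (fun d a b c => ⟨d, c, a, b, fun u => ?_⟩) <;>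
  simp [eval_polyA, eval_polyC, cubicA, cubicC, dotProduct, Fin.sum_univ_three] <;> ring

theorem invUnder_fifthTurn :
    InvUnder ((1 / 2 : ℝ) • !![1, -gtau, 1 / gtau; gtau, 1 / gtau, -1; 1 / gtau, 1, gtau]) AIco ∧
    InvUnder ((1 / 2 : ℝ) • !![1, -gtau, 1 / gtau; gtau, 1 / gtau, -1; 1 / gtau, 1, gtau])
      Cico := by
  have ht := gtau_sq
  rw [one_div_gtau]
  refine invUnder_of_eval (B := (1 / 2 : ℝ) •
      !![1, gtau, gtau - 1; -gtau, gtau - 1, 1; gtau - 1, -1, gtau]) ?_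
    (fun a b c => ?_) (fun d a b c => ?_)
  · generalize gtau = t at *
    ext i j
    fin_cases i <;> fin_cases j <;> simp [Matrix.mul_apply, Fin.sum_univ_three] <;> grind
  · refine ⟨a / 2 + (gtau - 1) / 2 * b - gtau / 2 * c, (1 - gtau) / 2 * a - gtau / 2 * b - c / 2,
      -gtau / 2 * a + b / 2 + (1 - gtau) / 2 * c, fun u => ?_⟩
    simp only [eval_polyA, cubicA]
    simp [Matrix.mulVec, dotProduct, Fin.sum_univ_three]
    generalize gtau = t at *
    grind
  · refine ⟨-d / 4 + 5 / 2 * (a - b - c), -d / 8 - 3 / 4 * a - b / 4 - c / 4,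
      -d / 8 + a / 4 - b / 4 + 3 / 4 * c, d / 8 - a / 4 - 3 / 4 * b + c / 4, fun u => ?_⟩
    simp only [eval_polyC, cubicC]
    simp [Matrix.mulVec, dotProduct, Fin.sum_univ_three]
    generalize gtau = t at *
    grind

theorem invUnder_of_mem_IcoSet {A : Matrix (Fin 3) (Fin 3) ℝ} (hA : A ∈ IcoSet) :
    InvUnder A AIco ∧ InvUnder A Cico := by
  refine Submonoid.closure_induction (motive := fun A _ => InvUnder A AIco ∧ InvUnder A Cico)
    ?_ ⟨.one _, .one _⟩ (fun _ _ _ _ h h' => ⟨h.1.mul h'.1, h.2.mul h'.2⟩) hA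
  rintro A (rfl | rfl | rfl)
  exacts [invUnder_halfTurn, invUnder_cyclic, invUnder_fifthTurn]

/-- The spanning family of `Cico`. -/
def gensCico : Fin 4 → Fin 7 → ℝ :=
    ![![0, 0, 0, 1, 0, 0, 0],
      ![√3, 0, 0, 0, -1, 0, 0],
      ![0, 3 + √5, 0, 0, 0, √3 * (√5 - 1), 0],
      ![0, 0, √5 - 3, 0, 0, 0, √3 * (1 + √5)]]

theorem span_range_gensCico : Submodule.span ℝ (Set.range gensCico) = Cico := by
  simp only [Cico, gensCico, Matrix.range_cons, Matrix.range_empty, Set.union_empty,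
    Set.singleton_union]

theorem linearIndependent_Cico : LinearIndependent ℝ gensCico := by
  have h1 : 3 + √5 ≠ 0 := by positivity
  have h2 : 1 + √5 ≠ 0 := by positivity
  rw [Fintype.linearIndependent_iff]
  intro g hg
  have e1 := congrFun hg 1
  have e3 := congrFun hg 3
  have e4 := congrFun hg 4
  have e6 := congrFun hg 6
  simp [gensCico, Fin.sum_univ_four, h1, h2] at e1 e3 e4 e6
  intro i
  fin_cases i <;> simp [e1, e3, e4, e6]

/-- The spanning family of `AIco`. -/
def gensAIco : Fin 3 → Fin 7 → ℝ :=
    ![![1, 0, 0, 0, √3, 0, 0],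
      ![0, √3 * (√5 - 1), 0, 0, 0, -(3 + √5), 0],
      ![0, 0, √3 * (1 + √5), 0, 0, 0, 3 - √5]]

theorem span_range_gensAIco : Submodule.span ℝ (Set.range gensAIco) = AIco := by
  simp only [AIco, gensAIco, Matrix.range_cons, Matrix.range_empty, Set.union_empty,
    Set.singleton_union]

theorem linearIndependent_AIco : LinearIndependent ℝ gensAIco := by
  have h1 : -√5 + -3 ≠ 0 := by
    have : 0 < 3 + √5 := by positivity
    linarith
  have h2 : 1 + √5 ≠ 0 := by positivity
  rw [Fintype.linearIndependent_iff]
  intro g hg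
  have e0 := congrFun hg 0
  have e2 := congrFun hg 2
  have e5 := congrFun hg 5
  simp [gensAIco, Fin.sum_univ_three, h1, h2] at e0 e2 e5
  intro i
  fin_cases i <;> simp [e0, e2, e5]

theorem finrank_Cico : Module.finrank ℝ Cico = 4 := by
  rw [← span_range_gensCico]
  exact finrank_span_eq_card linearIndependent_Cico

theorem finrank_AIco : Module.finrank ℝ AIco = 3 := by
  rw [← span_range_gensAIco]
  exact finrank_span_eq_card linearIndependent_AIco

theorem AIco_inf_Cico : AIco ⊓ Cico = ⊥ := by
  rw [eq_bot_iff]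
  rintro v ⟨hA, hC⟩
  obtain ⟨a, b, c, hA⟩ := mem_AIco.1 hA
  obtain ⟨d, a', b', c', hC⟩ := mem_Cico.1 hC
  have horth : dot7 v v = 0 := by
    nth_rw 1 [hA]
    rw [hC]
    simp [dot7, Fin.sum_univ_seven]
    ring
  have hv : v ⬝ᵥ v = 0 := horth
  exact dotProduct_self_eq_zero.1 hv

theorem AIco_sup_Cico : AIco ⊔ Cico = ⊤ := by
  refine Submodule.eq_top_of_disjoint _ _ ?_ (disjoint_iff.2 AIco_inf_Cico)
  simp [finrank_AIco, finrank_Cico]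

theorem eval_vertex_polyC (d a b c : ℝ) {u : Fin 3 → ℝ} (hu : u ∈ IcoVerts) :
    eval u (polyC d a b c) = 0 := by
  have ht := gtau_sq
  obtain ⟨s, r, hs, hr, h⟩ := hu
  have hs : s ^ 2 = 1 := by rcases hs with rfl | rfl <;> norm_num
  have hr : r ^ 2 = 1 := by rcases hr with rfl | rfl <;> norm_num
  rcases h with rfl | rfl | rfl <;> rw [eval_polyC] <;> simp [cubicC] <;>
    generalize gtau = t at * <;> grind

theorem isHomogeneous_polyC (d a b c : ℝ) : (polyC d a b c).IsHomogeneous 3 := by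
  have hX (i : Fin 3) : (X i : P3).IsHomogeneous 1 := isHomogeneous_X ℝ i
  have hcub (i j k : Fin 3) : (cubicC (C gtau) (X i) (X j) (X k) : P3).IsHomogeneous 3 := by
    refine (hX i).mul (((hX i).pow 2).sub ?_ |>.sub ?_)
    · have := (isHomogeneous_C (Fin 3) (gtau + 1)).mul ((hX j).pow 2)
      simpa using this
    · have h2 : (2 : P3) - C gtau = C (2 - gtau) := by rw [map_sub, map_ofNat]
      have := (isHomogeneous_C (Fin 3) (2 - gtau)).mul ((hX k).pow 2)
      rw [h2]
      simpa only [zero_add, one_mul, mul_one] using this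
  have hC {p : P3} (r : ℝ) (hp : p.IsHomogeneous 3) : (C r * p).IsHomogeneous 3 := by
    simpa using (isHomogeneous_C (Fin 3) r).mul hp
  exact (((hC d (((hX 0).mul (hX 1)).mul (hX 2))).add (hC a (hcub 0 1 2))).add
    (hC b (hcub 1 2 0))).add (hC c (hcub 2 0 1))

theorem lap_polyC (d a b c : ℝ) : lap (polyC d a b c) = 0 := by
  apply MvPolynomial.funext
  intro u
  have h2 (i : Fin 3) : pderiv i (2 : P3) = 0 := (pderiv i).map_natCast 2
  simp [lap, polyC, cubicC, Fin.sum_univ_three, pderiv_X, h2]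
  ring

/-- The general ternary cubic form. -/
def ternaryCubic (a : Fin 10 → ℝ) : P3 :=
  C (a 0) * X 0 ^ 3 + C (a 1) * X 1 ^ 3 + C (a 2) * X 2 ^ 3 + C (a 3) * (X 0 * X 1 ^ 2) +
    C (a 4) * (X 0 * X 2 ^ 2) + C (a 5) * (X 1 * X 2 ^ 2) + C (a 6) * (X 1 * X 0 ^ 2) +
    C (a 7) * (X 2 * X 0 ^ 2) + C (a 8) * (X 2 * X 1 ^ 2) + C (a 9) * (X 0 * X 1 * X 2)

theorem exists_eq_ternaryCubic {p : P3} (hp : p.IsHomogeneous 3) : ∃ a, p = ternaryCubic a := by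
  rw [p.as_sum]
  refine Finset.sum_induction _ (fun q => ∃ a, q = ternaryCubic a) ?_ ⟨0, by simp [ternaryCubic]⟩ ?_
  · rintro _ _ ⟨a, rfl⟩ ⟨b, rfl⟩
    exact ⟨a + b, by simp only [ternaryCubic, Pi.add_apply, map_add]; ring⟩
  · intro m hm
    have hdeg : m 0 + m 1 + m 2 = 3 := by
      have := hp (mem_support_iff.1 hm)
      simpa [Finsupp.weight_apply, Finsupp.sum_fintype, Fin.sum_univ_three] using this
    have hmon : monomial m (coeff m p) =
        C (coeff m p) * (X 0 ^ m 0 * X 1 ^ m 1 * X 2 ^ m 2 : P3) := by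
      rw [monomial_eq, Finsupp.prod_fintype _ _ (by simp), Fin.prod_univ_three]
    rw [hmon]
    generalize coeff m p = r
    generalize m 0 = i at *
    generalize m 1 = j at *
    obtain ⟨k, hk⟩ : ∃ k, m 2 = k := ⟨_, rfl⟩
    rw [hk] at hdeg ⊢
    have h0 : i ≤ 3 := by omega
    have h1 : j ≤ 3 := by omega
    obtain rfl : k = 3 - i - j := by omega
    interval_cases i <;> interval_cases j <;> try omega
    · exact ⟨Pi.single 2 r, by simp [ternaryCubic]⟩
    · exact ⟨Pi.single 5 r, by simp [ternaryCubic]⟩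
    · exact ⟨Pi.single 8 r, by simp [ternaryCubic, mul_comm]⟩
    · exact ⟨Pi.single 1 r, by simp [ternaryCubic]⟩
    · exact ⟨Pi.single 4 r, by simp [ternaryCubic]⟩
    · exact ⟨Pi.single 9 r, by simp [ternaryCubic]⟩
    · exact ⟨Pi.single 3 r, by simp [ternaryCubic]⟩
    · exact ⟨Pi.single 7 r, by simp [ternaryCubic, mul_comm]⟩
    · exact ⟨Pi.single 6 r, by simp [ternaryCubic, mul_comm]⟩
    · exact ⟨Pi.single 0 r, by simp [ternaryCubic]⟩

theorem eq_polyC_of_vanish {p : P3} (hp : p ∈ H3) (hv : ∀ u ∈ IcoVerts, eval u p = 0) :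
    ∃ d a b c : ℝ, p = polyC d a b c := by
  obtain ⟨a, rfl⟩ := exists_eq_ternaryCubic hp.1
  have hlap (u : Fin 3 → ℝ) : eval u (lap (ternaryCubic a)) = 0 := by
    rw [show lap (ternaryCubic a) = 0 from hp.2, map_zero]
  have h0 := hlap ![1, 0, 0]
  have h1 := hlap ![0, 1, 0]
  have h2 := hlap ![0, 0, 1]
  simp [lap, ternaryCubic, Fin.sum_univ_three, pderiv_X] at h0 h1 h2
  have hv1 (s r : ℝ) (hs : s = 1 ∨ s = -1) (hr : r = 1 ∨ r = -1) :=
    hv _ ⟨s, r, hs, hr, .inl rfl⟩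
  have hv2 (s r : ℝ) (hs : s = 1 ∨ s = -1) (hr : r = 1 ∨ r = -1) :=
    hv _ ⟨s, r, hs, hr, .inr (.inl rfl)⟩
  have hv3 (s r : ℝ) (hs : s = 1 ∨ s = -1) (hr : r = 1 ∨ r = -1) :=
    hv _ ⟨s, r, hs, hr, .inr (.inr rfl)⟩
  have e1 := hv1 1 1 (.inl rfl) (.inl rfl)
  have e2 := hv1 1 (-1) (.inl rfl) (.inr rfl)
  have e3 := hv2 1 1 (.inl rfl) (.inl rfl)
  have e4 := hv2 1 (-1) (.inl rfl) (.inr rfl)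
  have e5 := hv3 1 1 (.inl rfl) (.inl rfl)
  have e6 := hv3 1 (-1) (.inl rfl) (.inr rfl)
  simp [ternaryCubic] at e1 e2 e3 e4 e5 e6
  refine ⟨a 9, a 0, a 1, a 2, MvPolynomial.funext fun u => ?_⟩
  simp only [eval_polyC, ternaryCubic, cubicC]
  simp
  have ht := gtau_sq
  generalize gtau = t at *
  have : a 3 = - (t + 1) * a 0 := by grind
  have : a 4 = - (2 - t) * a 0 := by grind
  have : a 5 = - (t + 1) * a 1 := by grind
  have : a 6 = - (2 - t) * a 1 := by grind
  have : a 7 = - (t + 1) * a 2 := by grind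
  have : a 8 = - (2 - t) * a 2 := by grind
  grind

theorem polySet_Cico :
    polySet Cico = {p : P3 | p ∈ H3 ∧ ∀ u ∈ IcoVerts, MvPolynomial.eval u p = 0} := by
  ext p
  rw [mem_polySet_Cico, Set.mem_ofPred_eq]
  constructor
  · rintro ⟨d, a, b, c, rfl⟩
    exact ⟨⟨isHomogeneous_polyC d a b c, lap_polyC d a b c⟩,
      fun u hu => eval_vertex_polyC d a b c hu⟩
  · rintro ⟨hp, hv⟩
    exact eq_polyC_of_vanish hp hv

/-- `C` is 4-dimensional and equals the space of polynomials in `H₃`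
vanishing at the 12 icosahedron vertices; `H₃ = A_Ico ⊕ C`, and both summands are invariant
under the substitution action of every element of `Ico`. -/
theorem stmt3 :
    Module.finrank ℝ Cico = 4 ∧
    polySet Cico = {p : P3 | p ∈ H3 ∧ ∀ u ∈ IcoVerts, MvPolynomial.eval u p = 0} ∧
    AIco ⊔ Cico = ⊤ ∧ AIco ⊓ Cico = ⊥ ∧
    (∀ A ∈ IcoSet, InvUnder A AIco ∧ InvUnder A Cico) := by
  exact ⟨finrank_Cico, polySet_Cico, AIco_sup_Cico, AIco_inf_Cico,
    fun _ hA => invUnder_of_mem_IcoSet hA⟩
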